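/- arXiv:2112.05414 — 7 statements merged into one kernel-verified Lean document; each statement's English description precedes it below -/
import Mathlib

section
/- Let n₁, n₂, k be positive integers, let A be an n₁×n₁ real symmetric positive definite matrix and B an n₂×n₂ real symmetric positive definite matrix, let β ≥ 0, let ℓ₁ : ℝ^{n₁} → ℝ and ℓ₂ : ℝ^{n₂} → ℝ be linear maps, and let G : ℝ^{n₁} × ℝ^{n₂} × ℝ → ℝ^k be continuous. If the feasible set 𝒞 = {(z, ρ, λ) : G(z, ρ, λ) = 0} is nonempty, then the function f(z, ρ, λ) = zᵀA⁻¹z + ρᵀB⁻¹ρ + λ² + β(ℓ₂(ρ) − 1)² + β(ℓ₁(z))² attains its minimum on 𝒞, i.e., there exists (z†, ρ†, λ†) ∈ 𝒞 such that f(z†, ρ†, λ†) ≤ f(z, ρ, λ) for all (z, ρ, λ) ∈ 𝒞. -/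
open Matrix

open Filter

/-- The quadratic form of a positive definite real matrix is coercive. -/
theorem Matrix.PosDef.exists_pos_mul_norm_sq_le {n : Type*} [Fintype n] {M : Matrix n n ℝ}
    (hM : M.PosDef) : ∃ c > 0, ∀ x : n → ℝ, c * ‖x‖ ^ 2 ≤ x ⬝ᵥ (M *ᵥ x) := by
  have hcont : Continuous fun x : n → ℝ ↦ x ⬝ᵥ (M *ᵥ x) := by fun_prop
  obtain ⟨c, hc, hle⟩ := (isCompact_sphere (0 : n → ℝ) 1).exists_forall_le' hcont.continuousOn
    (a := 0) fun x hx ↦ by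
      simpa using hM.dotProduct_mulVec_pos (ne_zero_of_mem_unit_sphere ⟨x, hx⟩)
  refine ⟨c, hc, fun x ↦ ?_⟩
  rcases eq_or_ne x 0 with rfl | hx
  · simp
  have hnorm : 0 < ‖x‖ := norm_pos_iff.mpr hx
  have h := hle (‖x‖⁻¹ • x) (by simp [norm_smul, hnorm.ne'])
  simp only [mulVec_smul, dotProduct_smul, smul_dotProduct, smul_eq_mul] at h
  calc c * ‖x‖ ^ 2 ≤ ‖x‖⁻¹ * (‖x‖⁻¹ * (x ⬝ᵥ (M *ᵥ x))) * ‖x‖ ^ 2 := by gcongr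
    _ = x ⬝ᵥ (M *ᵥ x) := by field_simp

/-- Existence of a minimizer for the finite-dimensional optimal recovery problem
of the Gaussian process method (Theorem 2.1 / 3.1). -/
theorem stmt_0 (n₁ n₂ k : ℕ) (hn₁ : 0 < n₁) (hn₂ : 0 < n₂) (hk : 0 < k)
    (A : Matrix (Fin n₁) (Fin n₁) ℝ) (B : Matrix (Fin n₂) (Fin n₂) ℝ)
    (hA : A.PosDef) (hB : B.PosDef)
    (β : ℝ) (hβ : 0 ≤ β)
    (ℓ₁ : (Fin n₁ → ℝ) →ₗ[ℝ] ℝ) (ℓ₂ : (Fin n₂ → ℝ) →ₗ[ℝ] ℝ)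
    (G : (Fin n₁ → ℝ) × (Fin n₂ → ℝ) × ℝ → Fin k → ℝ) (hG : Continuous G)
    (hne : ∃ p, G p = 0) :
    ∃ p : (Fin n₁ → ℝ) × (Fin n₂ → ℝ) × ℝ, G p = 0 ∧
      ∀ q : (Fin n₁ → ℝ) × (Fin n₂ → ℝ) × ℝ, G q = 0 →
        p.1 ⬝ᵥ (A⁻¹ *ᵥ p.1) + p.2.1 ⬝ᵥ (B⁻¹ *ᵥ p.2.1) + p.2.2 ^ 2
          + β * (ℓ₂ p.2.1 - 1) ^ 2 + β * (ℓ₁ p.1) ^ 2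
        ≤ q.1 ⬝ᵥ (A⁻¹ *ᵥ q.1) + q.2.1 ⬝ᵥ (B⁻¹ *ᵥ q.2.1) + q.2.2 ^ 2
          + β * (ℓ₂ q.2.1 - 1) ^ 2 + β * (ℓ₁ q.1) ^ 2 := by
  set f : (Fin n₁ → ℝ) × (Fin n₂ → ℝ) × ℝ → ℝ := fun q ↦
    q.1 ⬝ᵥ (A⁻¹ *ᵥ q.1) + q.2.1 ⬝ᵥ (B⁻¹ *ᵥ q.2.1) + q.2.2 ^ 2
      + β * (ℓ₂ q.2.1 - 1) ^ 2 + β * (ℓ₁ q.1) ^ 2 with hf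
  have hcont : Continuous f := by
    have h₁ : Continuous ℓ₁ := ℓ₁.continuous_of_finiteDimensional
    have h₂ : Continuous ℓ₂ := ℓ₂.continuous_of_finiteDimensional
    fun_prop
  obtain ⟨a, ha, hAle⟩ := hA.inv.exists_pos_mul_norm_sq_le
  obtain ⟨b, hb, hBle⟩ := hB.inv.exists_pos_mul_norm_sq_le
  obtain ⟨m, hm, hma, hmb, hm1⟩ : ∃ m > 0, m ≤ a ∧ m ≤ b ∧ m ≤ 1 :=
    ⟨min a (min b 1), by positivity, by simp, by simp, by simp⟩
  have hbound (q) : m * ‖q‖ ^ 2 ≤ f q := by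
    have h₁ : m * ‖q.1‖ ^ 2 ≤ q.1 ⬝ᵥ (A⁻¹ *ᵥ q.1) := le_trans (by gcongr) (hAle q.1)
    have h₂ : m * ‖q.2.1‖ ^ 2 ≤ q.2.1 ⬝ᵥ (B⁻¹ *ᵥ q.2.1) := le_trans (by gcongr) (hBle q.2.1)
    have h₃ : m * ‖q.2.2‖ ^ 2 ≤ q.2.2 ^ 2 := by
      rw [Real.norm_eq_abs, sq_abs]
      exact mul_le_of_le_one_left (sq_nonneg _) hm1
    have h₄ : 0 ≤ β * (ℓ₂ q.2.1 - 1) ^ 2 := by positivity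
    have h₅ : 0 ≤ β * (ℓ₁ q.1) ^ 2 := by positivity
    have h₆ : 0 ≤ m * ‖q.1‖ ^ 2 := by positivity
    have h₇ : 0 ≤ m * ‖q.2.1‖ ^ 2 := by positivity
    have h₈ : 0 ≤ m * ‖q.2.2‖ ^ 2 := by positivity
    have hq : ‖q‖ = ‖q.1‖ ∨ ‖q‖ = ‖q.2.1‖ ∨ ‖q‖ = ‖q.2.2‖ := by
      rw [Prod.norm_def, Prod.norm_def]
      grind
    simp only [hf]
    rcases hq with hq | hq | hq <;> rw [hq] <;> linarith
  have hlim : Tendsto f (cocompact _) atTop :=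
    tendsto_atTop_mono hbound <|
      ((tendsto_pow_atTop two_ne_zero).comp tendsto_norm_cocompact_atTop).const_mul_atTop hm
  obtain ⟨p₀, hp₀⟩ := hne
  obtain ⟨p, hp, hmin⟩ := hcont.continuousOn.exists_isMinOn'
    (isClosed_singleton.preimage hG : IsClosed (G ⁻¹' {0})) hp₀
    ((hlim.eventually_ge_atTop (f p₀)).filter_mono inf_le_left)
  exact ⟨p, hp, fun q hq ↦ hmin hq⟩
end

section
/- Let m, n be positive integers, let A be an m×n real matrix, let Q₁ be an m×n real matrix with orthonormal columns (Q₁ᵀQ₁ = Iₙ), let R₁ be an n×n real matrix with A = Q₁R₁, and let μ > 0. Then the matrices R₁R₁ᵀ + μIₙ and AAᵀ + μI_m are invertible, and (AAᵀ + μI_m)⁻¹ = Q₁(R₁R₁ᵀ + μIₙ)⁻¹Q₁ᵀ + μ⁻¹(I_m − Q₁Q₁ᵀ). -/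
open Matrix

theorem Matrix.isUnit_mul_transpose_add_smul_one {k l : Type*} [Fintype k] [Fintype l]
    [DecidableEq k] (B : Matrix k l ℝ) {μ : ℝ} (hμ : 0 < μ) :
    IsUnit (B * Bᵀ + μ • (1 : Matrix k k ℝ)) := by
  have hB : (B * Bᵀ).PosSemidef := by
    simpa using posSemidef_self_mul_conjTranspose B
  exact (PosDef.posSemidef_add hB (PosDef.one.smul hμ)).isUnit

/-- If `Q` has orthonormal columns, a matrix acting as `M` on the column space of `Q` and as the
scalar `c` on its orthogonal complement is inverted by inverting `M` and `c` separately. -/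
theorem Matrix.conj_add_smul_mul_conj_inv_add_smul {K k l : Type*} [Field K] [Fintype k] [Fintype l]
    [DecidableEq k] [DecidableEq l] {Q : Matrix k l K} (hQ : Qᵀ * Q = 1) {M : Matrix l l K}
    (hM : IsUnit M) {c : K} (hc : c ≠ 0) :
    (Q * M * Qᵀ + c • (1 - Q * Qᵀ)) * (Q * M⁻¹ * Qᵀ + c⁻¹ • (1 - Q * Qᵀ)) = 1 := by
  have hQ_left (X : Matrix l k K) : Qᵀ * (Q * X) = X := by
    rw [← Matrix.mul_assoc, hQ, Matrix.one_mul]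
  have hM_left (X : Matrix l k K) : M * (M⁻¹ * X) = X := by
    rw [← Matrix.mul_assoc, mul_nonsing_inv _ ((isUnit_iff_isUnit_det _).mp hM), Matrix.one_mul]
  simp [Matrix.add_mul, Matrix.mul_add, Matrix.sub_mul, Matrix.mul_sub, Matrix.mul_assoc,
    hQ_left, hM_left, smul_smul, hc]

/-- The QR-based inversion identity of Remark 2.9:
`(AAᵀ + μI)⁻¹ = Q₁(R₁R₁ᵀ + μI)⁻¹Q₁ᵀ + μ⁻¹(I − Q₁Q₁ᵀ)` for a thin QR
decomposition `A = Q₁R₁` with `Q₁ᵀQ₁ = I` and `μ > 0`. -/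
theorem stmt_1 (m n : ℕ) (hm : 0 < m) (hn : 0 < n)
    (A Q₁ : Matrix (Fin m) (Fin n) ℝ) (R₁ : Matrix (Fin n) (Fin n) ℝ)
    (hQ : Q₁ᵀ * Q₁ = 1) (hQR : A = Q₁ * R₁) (μ : ℝ) (hμ : 0 < μ) :
    IsUnit (R₁ * R₁ᵀ + μ • (1 : Matrix (Fin n) (Fin n) ℝ)) ∧
    IsUnit (A * Aᵀ + μ • (1 : Matrix (Fin m) (Fin m) ℝ)) ∧
    (A * Aᵀ + μ • (1 : Matrix (Fin m) (Fin m) ℝ))⁻¹ =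
      Q₁ * (R₁ * R₁ᵀ + μ • (1 : Matrix (Fin n) (Fin n) ℝ))⁻¹ * Q₁ᵀ
        + μ⁻¹ • ((1 : Matrix (Fin m) (Fin m) ℝ) - Q₁ * Q₁ᵀ) := by
  have hR := isUnit_mul_transpose_add_smul_one R₁ hμ
  refine ⟨hR, isUnit_mul_transpose_add_smul_one A hμ, inv_eq_right_inv ?_⟩
  have hA : A * Aᵀ + μ • (1 : Matrix (Fin m) (Fin m) ℝ) =
      Q₁ * (R₁ * R₁ᵀ + μ • (1 : Matrix (Fin n) (Fin n) ℝ)) * Q₁ᵀ + μ • (1 - Q₁ * Q₁ᵀ) := by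
    simp [hQR, transpose_mul, Matrix.mul_add, Matrix.add_mul, Matrix.mul_assoc, smul_sub]
  rw [hA]
  exact conj_add_smul_mul_conj_inv_add_smul hQ hR hμ.ne'
end

section
/- Suppose V, b : ℝ → ℝ are continuous 1-periodic functions, b is continuously differentiable, and ∫₀¹ b(y) dy = 0. Define Z = ∫₀¹ e^{V(y) − b(y)²/2} dy, u(x) = ∫₀¹ (∫₀^t b(y) dy) dt − ∫₀^x b(y) dy, m(x) = e^{V(x) − b(x)²/2} / Z, and H̄ = ln Z. Then u and m are 1-periodic, u is differentiable with u'(x) = −b(x) for all x, and (u, m, H̄) solves the one-dimensional stationary mean field game: u'(x)²/2 + V(x) + b(x)u'(x) = ln m(x) + H̄ for all x ∈ ℝ, m(x)(u'(x) + b(x)) = 0 for all x ∈ ℝ (so the transport term (m(u'+b))' vanishes identically), ∫₀¹ m(x) dx = 1, and ∫₀¹ u(x) dx = 0. -/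
/-- The explicit formulas (2.2) solve the one-dimensional stationary mean field
game (2.1) when `∫₀¹ b = 0`. -/
theorem stmt_4 (V b : ℝ → ℝ)
    (hV : Continuous V) (hVp : ∀ x, V (x + 1) = V x)
    (hb : ContDiff ℝ 1 b) (hbp : ∀ x, b (x + 1) = b x)
    (hbint : (∫ y in (0:ℝ)..1, b y) = 0)
    (Z : ℝ) (hZ : Z = ∫ y in (0:ℝ)..1, Real.exp (V y - (b y) ^ 2 / 2))
    (u m : ℝ → ℝ) (Hbar : ℝ)
    (hu : ∀ x, u x = (∫ t in (0:ℝ)..1, ∫ y in (0:ℝ)..t, b y) - ∫ y in (0:ℝ)..x, b y)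
    (hm : ∀ x, m x = Real.exp (V x - (b x) ^ 2 / 2) / Z)
    (hH : Hbar = Real.log Z) :
    (∀ x, u (x + 1) = u x) ∧ (∀ x, m (x + 1) = m x) ∧
    (∀ x, HasDerivAt u (-(b x)) x) ∧
    (∀ x, (deriv u x) ^ 2 / 2 + V x + b x * deriv u x = Real.log (m x) + Hbar) ∧
    (∀ x, m x * (deriv u x + b x) = 0) ∧
    (∫ x in (0:ℝ)..1, m x) = 1 ∧
    (∫ x in (0:ℝ)..1, u x) = 0 := by
  have hbc : Continuous b := hb.continuous
  have hbi : ∀ x y, IntervalIntegrable b MeasureTheory.volume x y :=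
    fun x y => hbc.intervalIntegrable x y
  have hec : Continuous fun y => Real.exp (V y - (b y) ^ 2 / 2) := by fun_prop
  have hZpos : 0 < Z := by
    rw [hZ]
    exact intervalIntegral.intervalIntegral_pos_of_pos (hec.intervalIntegrable _ _)
      (fun _ => Real.exp_pos _) one_pos
  have hF : ∀ x, HasDerivAt (fun x => ∫ y in (0:ℝ)..x, b y) (b x) x := fun x =>
    intervalIntegral.integral_hasDerivAt_right (hbi 0 x)
      hbc.stronglyMeasurable.stronglyMeasurableAtFilter hbc.continuousAt
  have hFc : Continuous fun x => ∫ y in (0:ℝ)..x, b y :=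
    continuous_iff_continuousAt.2 fun x => (hF x).continuousAt
  have hd : ∀ x, HasDerivAt u (-(b x)) x := fun x => by
    rw [funext hu]
    exact (hF x).const_sub _
  refine ⟨fun x => ?_, fun x => ?_, hd, fun x => ?_, fun x => ?_, ?_, ?_⟩
  · have hper : Function.Periodic b 1 := hbp
    have hshift : (∫ y in x..x + 1, b y) = 0 := by
      rw [hper.intervalIntegral_add_eq x 0, zero_add, hbint]
    rw [hu, hu, ← intervalIntegral.integral_add_adjacent_intervals (hbi 0 x) (hbi x (x + 1)),
      hshift, add_zero]
  · rw [hm, hm, hVp, hbp]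
  · rw [(hd x).deriv, hm, hH, Real.log_div (Real.exp_ne_zero _) hZpos.ne', Real.log_exp]
    ring
  · rw [(hd x).deriv, neg_add_cancel, mul_zero]
  · simp_rw [hm]
    rw [intervalIntegral.integral_div, ← hZ, div_self hZpos.ne']
  · simp_rw [hu]
    rw [intervalIntegral.integral_sub intervalIntegrable_const (hFc.intervalIntegrable _ _),
      intervalIntegral.integral_const]
    simp
end

section
/- Let V, b : ℝ → ℝ be 1-periodic with V continuous and b continuously differentiable, let N be a positive integer and γ > 0. Then the minimization of J_γ(u, m, H̄) over all u ∈ 𝒢^N, m ∈ 𝒢^N and H̄ ∈ ℝ admits a minimizer: there exist u† ∈ 𝒢^N, m† ∈ 𝒢^N and H̄† ∈ ℝ such that J_γ(u†, m†, H̄†) ≤ J_γ(u, m, H̄) for all u, m ∈ 𝒢^N and H̄ ∈ ℝ. -/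
/-- Membership in the one-dimensional Fourier features space `𝒢^N`:
functions of the form `c + Σ_{i=1}^N αᵢ sin(2πix) + Σ_{i=1}^N βᵢ cos(2πix)`. -/
def inG (N : ℕ) (φ : ℝ → ℝ) : Prop :=
  ∃ (c : ℝ) (α β : ℕ → ℝ), ∀ x, φ x =
    c + (∑ i ∈ Finset.Icc 1 N, α i * Real.sin (2 * Real.pi * i * x))
      + ∑ i ∈ Finset.Icc 1 N, β i * Real.cos (2 * Real.pi * i * x)

/-- The residual functional `Q(u, m, H̄)` of the one-dimensional stationary
MFG, with Hamiltonian `H(x,p) = V(x) + p²/2 + b(x)p`. -/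
noncomputable def Qfun (V b u m : ℝ → ℝ) (Hbar : ℝ) : ℝ :=
  (∫ x in (0:ℝ)..1,
      (Real.exp (V x + (deriv u x) ^ 2 / 2 + b x * deriv u x - Hbar) - m x) ^ 2)
  + (∫ x in (0:ℝ)..1, u x) ^ 2
  + ((∫ x in (0:ℝ)..1, m x) - 1) ^ 2
  + ∫ x in (0:ℝ)..1,
      (m x * (deriv (deriv u) x + deriv b x) + deriv m x * (deriv u x + b x)) ^ 2

/-- The penalized objective `J_γ(u, m, H̄)`. -/
noncomputable def Jfun (V b : ℝ → ℝ) (γ : ℝ) (u m : ℝ → ℝ) (Hbar : ℝ) : ℝ :=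
  (∫ x in (0:ℝ)..1, (u x) ^ 2) + (∫ x in (0:ℝ)..1, (m x) ^ 2) + Hbar ^ 2
    + γ * Qfun V b u m Hbar

/-- The linear combination of the functions `e i` with coefficients `a i`. -/
def linComb {d : ℕ} (e : Fin d → ℝ → ℝ) (a : Fin d → ℝ) (x : ℝ) : ℝ := ∑ i, a i * e i x

theorem continuous_linComb {d : ℕ} {e : Fin d → ℝ → ℝ} (he : ∀ i, Continuous (e i)) :
    Continuous fun p : (Fin d → ℝ) × ℝ => linComb e p.1 p.2 := by
  unfold linComb
  fun_prop

theorem deriv_linComb {d : ℕ} {e : Fin d → ℝ → ℝ} (he : ∀ i, Differentiable ℝ (e i))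
    (a : Fin d → ℝ) : deriv (linComb e a) = linComb (fun i => deriv (e i)) a := by
  ext x
  have h : HasDerivAt (fun y => ∑ i, a i * e i y) (∑ i, a i * deriv (e i) x) x :=
    HasDerivAt.fun_sum fun i _ => ((he i x).hasDerivAt.const_mul (a i))
  exact h.deriv

theorem linComb_smul {d : ℕ} (e : Fin d → ℝ → ℝ) (r : ℝ) (a : Fin d → ℝ) (x : ℝ) :
    linComb e (r • a) x = r * linComb e a x := by
  simp [linComb, Finset.mul_sum, mul_assoc]

theorem integral_sq_pos_of_periodic {f : ℝ → ℝ} (hf : Continuous f)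
    (hp : Function.Periodic f 1) (h0 : f ≠ 0) : 0 < ∫ x in (0:ℝ)..1, f x ^ 2 := by
  obtain ⟨x, hx⟩ := Function.ne_iff.mp h0
  obtain ⟨y, hy, hxy⟩ := hp.exists_mem_Ico₀ one_pos x
  refine intervalIntegral.integral_pos one_pos (by fun_prop) (fun _ _ => sq_nonneg _)
    ⟨y, ⟨hy.1, hy.2.le⟩, ?_⟩
  rw [hxy] at hx
  exact sq_pos_of_ne_zero hx

/-- The `L²(0,1)` norm controls the coefficients of linear combinations of linearly independent
continuous periodic functions. -/
theorem exists_integral_linComb_sq_ge {d : ℕ} {e : Fin d → ℝ → ℝ} (he : ∀ i, Continuous (e i))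
    (hp : ∀ i, Function.Periodic (e i) 1) (hli : LinearIndependent ℝ e) :
    ∃ c > 0, ∀ a : Fin d → ℝ, c * ‖a‖ ^ 2 ≤ ∫ x in (0:ℝ)..1, linComb e a x ^ 2 := by
  have hcont : Continuous fun a : Fin d → ℝ => ∫ x in (0:ℝ)..1, linComb e a x ^ 2 :=
    intervalIntegral.continuous_parametric_intervalIntegral_of_continuous'
      ((continuous_linComb he).pow 2) 0 1
  have hunit : ∀ a : Fin d → ℝ, a ≠ 0 → ‖a‖⁻¹ • a ∈ Metric.sphere (0 : Fin d → ℝ) 1 := by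
    intro a ha
    simpa using norm_smul_inv_norm (𝕜 := ℝ) ha
  rcases (Metric.sphere (0 : Fin d → ℝ) 1).eq_empty_or_nonempty with hS | hS
  · refine ⟨1, one_pos, fun a => ?_⟩
    have ha : a = 0 := by
      by_contra ha
      simpa [hS] using hunit a ha
    simp [ha, linComb]
  obtain ⟨a₀, ha₀, hmin⟩ := (isCompact_sphere (0 : Fin d → ℝ) 1).exists_isMinOn hS
    hcont.continuousOn
  have ha₀' : a₀ ≠ 0 := by
    rintro rfl
    simp at ha₀
  refine ⟨∫ x in (0:ℝ)..1, linComb e a₀ x ^ 2, ?_, fun a => ?_⟩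
  · refine integral_sq_pos_of_periodic
      ((continuous_linComb he).comp (Continuous.prodMk_right a₀)) (fun x => ?_) fun h => ha₀' ?_
    · simp only [linComb, fun i => hp i x]
    · refine funext (Fintype.linearIndependent_iff.mp hli a₀ ?_)
      ext x
      simpa [linComb] using congrFun h x
  · by_cases ha : a = 0
    · simp [ha, linComb]
    have hn : 0 < ‖a‖ := norm_pos_iff.mpr ha
    have h := hmin (hunit a ha)
    simp only [Set.mem_ofPred_eq, linComb_smul, mul_pow, intervalIntegral.integral_const_mul] at h
    rw [inv_pow, inv_mul_eq_div, le_div_iff₀ (by positivity)] at h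
    exact h

theorem inG.contDiff {N : ℕ} {φ : ℝ → ℝ} (h : inG N φ) : ContDiff ℝ 2 φ := by
  obtain ⟨c, α, β, h⟩ := h
  rw [funext h]
  fun_prop

theorem inG.periodic {N : ℕ} {φ : ℝ → ℝ} (h : inG N φ) : Function.Periodic φ 1 := by
  obtain ⟨c, α, β, h⟩ := h
  intro x
  have hx : ∀ i : ℕ, 2 * Real.pi * i * (x + 1) = 2 * Real.pi * i * x + i * (2 * Real.pi) :=
    fun i => by ring
  simp only [h, hx, Real.sin_add_nat_mul_two_pi, Real.cos_add_nat_mul_two_pi]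

/-- The Fourier features space as a subspace of the space of all functions. -/
def fourierSubmodule (N : ℕ) : Submodule ℝ (ℝ → ℝ) where
  carrier := {φ | inG N φ}
  add_mem' := by
    rintro φ ψ ⟨c, α, β, h⟩ ⟨c', α', β', h'⟩
    refine ⟨c + c', α + α', β + β', fun x => ?_⟩
    simp only [Pi.add_apply, h, h', add_mul, Finset.sum_add_distrib]
    ring
  zero_mem' := ⟨0, 0, 0, by simp⟩
  smul_mem' := by
    rintro r φ ⟨c, α, β, h⟩
    refine ⟨r * c, r • α, r • β, fun x => ?_⟩
    simp only [Pi.smul_apply, smul_eq_mul, h, mul_add, Finset.mul_sum, mul_assoc]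

instance finiteDimensional_fourierSubmodule (N : ℕ) :
    FiniteDimensional ℝ (fourierSubmodule N) := by
  let S : Set (ℝ → ℝ) := {fun _ => 1} ∪
    ((fun (i : ℕ) (x : ℝ) => Real.sin (2 * Real.pi * i * x)) '' (Finset.Icc 1 N) ∪
      (fun (i : ℕ) (x : ℝ) => Real.cos (2 * Real.pi * i * x)) '' (Finset.Icc 1 N))
  have hS : S.Finite := (Set.finite_singleton _).union
    (((Finset.finite_toSet _).image _).union ((Finset.finite_toSet _).image _))
  have : FiniteDimensional ℝ (Submodule.span ℝ S) := FiniteDimensional.span_of_finite ℝ hS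
  refine Submodule.finiteDimensional_of_le (S₂ := Submodule.span ℝ S) ?_
  rintro φ ⟨c, α, β, h⟩
  have hφ : φ = c • (fun _ => (1 : ℝ))
      + (∑ i ∈ Finset.Icc 1 N, α i • fun x : ℝ => Real.sin (2 * Real.pi * i * x))
      + ∑ i ∈ Finset.Icc 1 N, β i • fun x : ℝ => Real.cos (2 * Real.pi * i * x) := by
    ext x
    simp [h]
  rw [hφ]
  refine add_mem (add_mem (Submodule.smul_mem _ _ (Submodule.subset_span (Or.inl rfl)))
    (sum_mem fun i hi => Submodule.smul_mem _ _ (Submodule.subset_span ?_)))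
    (sum_mem fun i hi => Submodule.smul_mem _ _ (Submodule.subset_span ?_))
  · exact Or.inr (Or.inl ⟨i, hi, rfl⟩)
  · exact Or.inr (Or.inr ⟨i, hi, rfl⟩)

theorem continuous_Jfun_linComb {V b : ℝ → ℝ} (hV : Continuous V) (hb : ContDiff ℝ 1 b) (γ : ℝ)
    {d : ℕ} {e : Fin d → ℝ → ℝ} (he : ∀ i, ContDiff ℝ 2 (e i)) :
    Continuous fun p : (Fin d → ℝ) × (Fin d → ℝ) × ℝ =>
      Jfun V b γ (linComb e p.1) (linComb e p.2.1) p.2.2 := by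
  have hd : ∀ i, ContDiff ℝ 1 (deriv (e i)) := fun i =>
    ((contDiff_succ_iff_deriv (n := 1)).mp (he i)).2.2
  have hb' : Continuous (deriv b) := hb.continuous_deriv le_rfl
  have hbc := hb.continuous
  have hc₀ := continuous_linComb fun i => (he i).continuous
  have hc₁ := continuous_linComb fun i => (hd i).continuous
  have hc₂ := continuous_linComb fun i => (hd i).continuous_deriv le_rfl
  have hu : Continuous fun q : ((Fin d → ℝ) × (Fin d → ℝ) × ℝ) × ℝ => linComb e q.1.1 q.2 :=
    hc₀.comp (by fun_prop : Continuous fun q : ((Fin d → ℝ) × (Fin d → ℝ) × ℝ) × ℝ =>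
      (q.1.1, q.2))
  have hm : Continuous fun q : ((Fin d → ℝ) × (Fin d → ℝ) × ℝ) × ℝ => linComb e q.1.2.1 q.2 :=
    hc₀.comp (by fun_prop : Continuous fun q : ((Fin d → ℝ) × (Fin d → ℝ) × ℝ) × ℝ =>
      (q.1.2.1, q.2))
  have hu₁ : Continuous fun q : ((Fin d → ℝ) × (Fin d → ℝ) × ℝ) × ℝ =>
      linComb (fun i => deriv (e i)) q.1.1 q.2 :=
    hc₁.comp (by fun_prop : Continuous fun q : ((Fin d → ℝ) × (Fin d → ℝ) × ℝ) × ℝ =>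
      (q.1.1, q.2))
  have hm₁ : Continuous fun q : ((Fin d → ℝ) × (Fin d → ℝ) × ℝ) × ℝ =>
      linComb (fun i => deriv (e i)) q.1.2.1 q.2 :=
    hc₁.comp (by fun_prop : Continuous fun q : ((Fin d → ℝ) × (Fin d → ℝ) × ℝ) × ℝ =>
      (q.1.2.1, q.2))
  have hu₂ : Continuous fun q : ((Fin d → ℝ) × (Fin d → ℝ) × ℝ) × ℝ =>
      linComb (fun i => deriv (deriv (e i))) q.1.1 q.2 :=
    hc₂.comp (by fun_prop : Continuous fun q : ((Fin d → ℝ) × (Fin d → ℝ) × ℝ) × ℝ =>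
      (q.1.1, q.2))
  have hint : ∀ F : (Fin d → ℝ) × (Fin d → ℝ) × ℝ → ℝ → ℝ, Continuous (Function.uncurry F) →
      Continuous fun p => ∫ x in (0:ℝ)..1, F p x := fun F hF =>
    intervalIntegral.continuous_parametric_intervalIntegral_of_continuous' hF 0 1
  simp only [Jfun, Qfun, deriv_linComb fun i => (he i).differentiable two_ne_zero,
    deriv_linComb fun i => (hd i).differentiable one_ne_zero]
  refine (((hint _ ?_).add (hint _ ?_)).add (by fun_prop)).add (continuous_const.mul
    ((((hint _ ?_).add ((hint _ ?_).pow 2)).add (((hint _ ?_).sub continuous_const).pow 2)).add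
      (hint _ ?_))) <;> simp only [Function.uncurry_def] <;> fun_prop

theorem Qfun_nonneg (V b u m : ℝ → ℝ) (Hbar : ℝ) : 0 ≤ Qfun V b u m Hbar := by
  have h : ∀ f : ℝ → ℝ, 0 ≤ ∫ x in (0:ℝ)..1, f x ^ 2 := fun f =>
    intervalIntegral.integral_nonneg zero_le_one fun _ _ => sq_nonneg _
  exact add_nonneg (add_nonneg (add_nonneg (h _) (sq_nonneg _)) (sq_nonneg _)) (h _)

theorem tendsto_Jfun_linComb (V b : ℝ → ℝ) {γ : ℝ} (hγ : 0 < γ) {d : ℕ} {e : Fin d → ℝ → ℝ}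
    (he : ∀ i, Continuous (e i)) (hp : ∀ i, Function.Periodic (e i) 1)
    (hli : LinearIndependent ℝ e) :
    Filter.Tendsto (fun p : (Fin d → ℝ) × (Fin d → ℝ) × ℝ =>
      Jfun V b γ (linComb e p.1) (linComb e p.2.1) p.2.2) (Filter.cocompact _) Filter.atTop := by
  obtain ⟨c, hc, hle⟩ := exists_integral_linComb_sq_ge he hp hli
  have hmin : 0 < min c 1 := lt_min hc one_pos
  refine Filter.tendsto_atTop_mono (fun p => ?_) (((Filter.tendsto_pow_atTop two_ne_zero).comp
    (tendsto_norm_cocompact_atTop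
      (E := (Fin d → ℝ) × (Fin d → ℝ) × ℝ))).const_mul_atTop hmin)
  obtain ⟨a, a', H⟩ := p
  have hQ := mul_nonneg hγ.le (Qfun_nonneg V b (linComb e a) (linComb e a') H)
  have h₁ := hle a
  have h₂ := hle a'
  have m₁ : min c 1 * ‖a‖ ^ 2 ≤ c * ‖a‖ ^ 2 := by gcongr; exact min_le_left _ _
  have m₂ : min c 1 * ‖a'‖ ^ 2 ≤ c * ‖a'‖ ^ 2 := by gcongr; exact min_le_left _ _
  have m₃ : min c 1 * ‖H‖ ^ 2 ≤ H ^ 2 := by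
    rw [Real.norm_eq_abs, sq_abs]
    exact mul_le_of_le_one_left (sq_nonneg _) (min_le_right _ _)
  have n₁ : 0 ≤ min c 1 * ‖a‖ ^ 2 := by positivity
  have n₂ : 0 ≤ min c 1 * ‖a'‖ ^ 2 := by positivity
  have n₃ : 0 ≤ min c 1 * ‖H‖ ^ 2 := by positivity
  simp only [Function.comp_apply, Jfun]
  rw [Prod.norm_mk, Prod.norm_mk]
  rcases max_choice ‖a‖ (max ‖a'‖ ‖H‖) with h | h <;> rw [h]
  · linarith
  · rcases max_choice ‖a'‖ ‖H‖ with h' | h' <;> rw [h'] <;> linarith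

/-- Existence of a minimizer of `J_γ` over `𝒢^N × 𝒢^N × ℝ` (Theorem 2.3). -/
theorem stmt_5 (V b : ℝ → ℝ)
    (hV : Continuous V) (hVp : ∀ x, V (x + 1) = V x)
    (hb : ContDiff ℝ 1 b) (hbp : ∀ x, b (x + 1) = b x)
    (N : ℕ) (hN : 0 < N) (γ : ℝ) (hγ : 0 < γ) :
    ∃ (u0 m0 : ℝ → ℝ) (H0 : ℝ), inG N u0 ∧ inG N m0 ∧
      ∀ (u m : ℝ → ℝ) (Hbar : ℝ), inG N u → inG N m →
        Jfun V b γ u0 m0 H0 ≤ Jfun V b γ u m Hbar := by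
  let B := Module.finBasis ℝ (fourierSubmodule N)
  let e : Fin (Module.finrank ℝ (fourierSubmodule N)) → ℝ → ℝ := fun i => (B i : ℝ → ℝ)
  have he : ∀ i, inG N (e i) := fun i => (B i).2
  have hli : LinearIndependent ℝ e :=
    B.linearIndependent.map' (fourierSubmodule N).subtype (Submodule.ker_subtype _)
  have hmem : ∀ a, inG N (linComb e a) := fun a => by
    have h : linComb e a = ∑ i, a i • e i := by
      ext x
      simp [linComb]
    rw [h]
    exact Submodule.sum_mem (fourierSubmodule N) fun i _ => Submodule.smul_mem _ _ (he i)
  have hrepr : ∀ φ, inG N φ → ∃ a, φ = linComb e a := fun φ hφ => by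
    refine ⟨B.repr ⟨φ, hφ⟩, ?_⟩
    have h := congrArg (fourierSubmodule N).subtype (B.sum_repr ⟨φ, hφ⟩)
    rw [map_sum] at h
    ext x
    simpa only [linComb, e, map_smul, Submodule.subtype_apply, Finset.sum_apply, Pi.smul_apply,
      smul_eq_mul] using (congrFun h x).symm
  obtain ⟨⟨a, a', H⟩, hmin⟩ :=
    (continuous_Jfun_linComb hV hb γ fun i => (he i).contDiff).exists_forall_le
      (tendsto_Jfun_linComb V b hγ (fun i => (he i).contDiff.continuous)
        (fun i => (he i).periodic) hli)
  refine ⟨linComb e a, linComb e a', H, hmem a, hmem a', fun u m Hbar hu hm => ?_⟩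
  obtain ⟨p, rfl⟩ := hrepr u hu
  obtain ⟨q, rfl⟩ := hrepr m hm
  exact hmin (p, q, Hbar)
end

section
/- Let V, b : ℝ → ℝ be smooth (infinitely differentiable) 1-periodic functions, and let (u*, m*, H̄*) be a solution of the one-dimensional stationary mean field game with u*, m* smooth and 1-periodic and m*(x) > 0 for all x. Then there exists a constant C > 0 such that for every ε ∈ (0,1) and every γ > 0 there exist N ∈ ℕ and functions u^N, m^N ∈ 𝒢^N with J_γ(u^N, m^N, H̄*) ≤ 2∫₀¹ (u*)² dx + 2∫₀¹ (m*)² dx + (H̄*)² + C(1+γ)ε². -/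
theorem inG.mono {N M : ℕ} {φ : ℝ → ℝ} (h : inG N φ) (hNM : N ≤ M) : inG M φ := by
  obtain ⟨c, α, β, h⟩ := h
  have key : ∀ (a : ℕ → ℝ) (g : ℕ → ℝ), ∑ i ∈ Finset.Icc 1 N, a i * g i
      = ∑ i ∈ Finset.Icc 1 M, (if i ≤ N then a i else 0) * g i := by
    intro a g
    rw [← Finset.sum_subset (Finset.Icc_subset_Icc_right hNM)]
    · refine Finset.sum_congr rfl fun i hi => ?_
      rw [if_pos (Finset.mem_Icc.1 hi).2]
    · intro i hi hi'
      rw [if_neg, zero_mul]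
      intro hiN
      exact hi' (Finset.mem_Icc.2 ⟨(Finset.mem_Icc.1 hi).1, hiN⟩)
  refine ⟨c, fun i => if i ≤ N then α i else 0, fun i => if i ≤ N then β i else 0, fun x => ?_⟩
  rw [h, key α fun i => Real.sin (2 * Real.pi * i * x),
    key β fun i => Real.cos (2 * Real.pi * i * x)]

theorem inG.add {N : ℕ} {φ ψ : ℝ → ℝ} (hφ : inG N φ) (hψ : inG N ψ) :
    inG N fun x => φ x + ψ x := by
  obtain ⟨c, α, β, h⟩ := hφ
  obtain ⟨c', α', β', h'⟩ := hψ
  refine ⟨c + c', fun i => α i + α' i, fun i => β i + β' i, fun x => ?_⟩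
  simp only [h, h', add_mul, Finset.sum_add_distrib]
  ring

theorem inG.const_mul {N : ℕ} {φ : ℝ → ℝ} (a : ℝ) (hφ : inG N φ) :
    inG N fun x => a * φ x := by
  obtain ⟨c, α, β, h⟩ := hφ
  refine ⟨a * c, fun i => a * α i, fun i => a * β i, fun x => ?_⟩
  simp only [h, mul_add, Finset.mul_sum, mul_assoc]

theorem inG_const (N : ℕ) (a : ℝ) : inG N fun _ => a :=
  ⟨a, fun _ => 0, fun _ => 0, fun x => by simp⟩

theorem inG_sin (k : ℕ) : inG k fun x => Real.sin (2 * Real.pi * k * x) := by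
  rcases Nat.eq_zero_or_pos k with rfl | hk
  · simpa using inG_const 0 0
  · refine ⟨0, Pi.single k 1, fun _ => 0, fun x => ?_⟩
    rw [Finset.sum_eq_single k]
    · simp
    · intro i _ hi
      simp [Pi.single_eq_of_ne hi]
    · intro h
      exact absurd (Finset.mem_Icc.2 ⟨hk, le_rfl⟩) h

theorem inG_cos (k : ℕ) : inG k fun x => Real.cos (2 * Real.pi * k * x) := by
  rcases Nat.eq_zero_or_pos k with rfl | hk
  · simpa using inG_const 0 1
  · refine ⟨0, fun _ => 0, Pi.single k 1, fun x => ?_⟩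
    rw [Finset.sum_eq_single (s := Finset.Icc 1 k) (f := fun i => _ * Real.cos _) k]
    · simp
    · intro i _ hi
      simp [Pi.single_eq_of_ne hi]
    · intro h
      exact absurd (Finset.mem_Icc.2 ⟨hk, le_rfl⟩) h

/-- The real and imaginary parts of a finite combination of Fourier monomials are real
trigonometric polynomials. -/
theorem exists_inG_re_im_of_mem_span {p : C(AddCircle (1 : ℝ), ℂ)}
    (hp : p ∈ Submodule.span ℂ (Set.range (fourier (T := (1 : ℝ))))) :
    ∃ N, inG N (fun x : ℝ => (p x).re) ∧ inG N (fun x : ℝ => (p x).im) := by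
  induction hp using Submodule.span_induction with
  | mem p hp =>
    obtain ⟨n, rfl⟩ := hp
    have hexp : ∀ x : ℝ, fourier (T := (1 : ℝ)) n x
        = Complex.exp ((2 * Real.pi * n * x : ℝ) * Complex.I) := by
      intro x
      rw [fourier_coe_apply]
      congr 1
      push_cast
      ring
    simp only [hexp, Complex.exp_ofReal_mul_I_re, Complex.exp_ofReal_mul_I_im]
    rcases Int.eq_nat_or_neg n with ⟨k, rfl | rfl⟩
    · exact ⟨k, by simpa using inG_cos k, by simpa using inG_sin k⟩
    · exact ⟨k, by simpa using inG_cos k, by simpa using (inG_sin k).const_mul (-1)⟩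
  | zero => exact ⟨0, by simpa using inG_const 0 0, by simpa using inG_const 0 0⟩
  | add p q _ _ hp hq =>
    obtain ⟨N, h1, h2⟩ := hp
    obtain ⟨M, h3, h4⟩ := hq
    exact ⟨max N M, (h1.mono (le_max_left _ _)).add (h3.mono (le_max_right _ _)),
      (h2.mono (le_max_left _ _)).add (h4.mono (le_max_right _ _))⟩
  | smul a p _ hp =>
    obtain ⟨N, h1, h2⟩ := hp
    refine ⟨N, ?_, ?_⟩
    · simpa [sub_eq_add_neg] using (h1.const_mul a.re).add (h2.const_mul (-a.im))
    · simpa using (h2.const_mul a.re).add (h1.const_mul a.im)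

/-- Trigonometric polynomials are uniformly dense in the continuous `1`-periodic functions. -/
theorem exists_inG_approx {f : ℝ → ℝ} (hf : Continuous f) (hfp : Function.Periodic f 1)
    {δ : ℝ} (hδ : 0 < δ) : ∃ N p, inG N p ∧ ∀ x, |f x - p x| ≤ δ := by
  have hlift : Continuous (hfp.lift : AddCircle (1 : ℝ) → ℝ) :=
    continuous_coinduced_dom.mpr hf
  let F : C(AddCircle (1 : ℝ), ℂ) := ⟨fun x => ((hfp.lift x : ℝ) : ℂ), by fun_prop⟩
  have hF : F ∈ (Submodule.span ℂ
      (Set.range (fourier (T := (1 : ℝ))))).topologicalClosure := by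
    rw [span_fourier_closure_eq_top]
    trivial
  obtain ⟨p, hp, hFp⟩ := Metric.mem_closure_iff.1 hF δ hδ
  obtain ⟨N, hN, -⟩ := exists_inG_re_im_of_mem_span hp
  refine ⟨N, _, hN, fun x => ?_⟩
  have hx : F x = (f x : ℂ) := rfl
  calc |f x - (p x).re| = |(F x - p x).re| := by simp [hx]
    _ ≤ ‖F x - p x‖ := Complex.abs_re_le_norm _
    _ ≤ ‖F - p‖ := (F - p).norm_coe_le_norm x
    _ ≤ δ := by rw [← dist_eq_norm]; exact hFp.le

theorem inG.exists_primitive {N : ℕ} {p : ℝ → ℝ} (hp : inG N p) (a : ℝ) :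
    ∃ c F, inG N F ∧ F 0 = a ∧ F 1 = a ∧ ∀ x, HasDerivAt F (p x - c) x := by
  obtain ⟨c, α, β, h⟩ := hp
  let G : ℝ → ℝ := fun x =>
    (∑ i ∈ Finset.Icc 1 N, β i / (2 * Real.pi * i) * Real.sin (2 * Real.pi * i * x))
      + ∑ i ∈ Finset.Icc 1 N, -α i / (2 * Real.pi * i) * Real.cos (2 * Real.pi * i * x)
  have hG : G 1 = G 0 := by
    have hs : ∀ i : ℕ, Real.sin (2 * Real.pi * i) = 0 := fun i => by
      simpa [mul_comm, mul_assoc, mul_left_comm] using Real.sin_nat_mul_pi (2 * i)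
    have hc : ∀ i : ℕ, Real.cos (2 * Real.pi * i) = 1 := fun i => by
      simpa [mul_comm, mul_assoc, mul_left_comm] using Real.cos_nat_mul_two_pi i
    simp [G, hs, hc]
  have hlin : ∀ (i : ℕ) (x : ℝ),
      HasDerivAt (fun x : ℝ => 2 * Real.pi * i * x) (2 * Real.pi * i) x := fun i x => by
    simpa using (hasDerivAt_id x).const_mul (2 * Real.pi * i)
  refine ⟨c, fun x => (a - G 0) + G x, ⟨a - G 0, _, _, fun x => add_assoc _ _ _ |>.symm⟩,
    by simp, by simp [hG], fun x => ?_⟩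
  have hd : HasDerivAt G
      ((∑ i ∈ Finset.Icc 1 N, β i / (2 * Real.pi * i)
          * (Real.cos (2 * Real.pi * i * x) * (2 * Real.pi * i)))
        + ∑ i ∈ Finset.Icc 1 N, -α i / (2 * Real.pi * i)
          * (-Real.sin (2 * Real.pi * i * x) * (2 * Real.pi * i))) x := by
    refine HasDerivAt.add ?_ ?_
    · exact HasDerivAt.fun_sum fun i _ => ((hlin i x).sin).const_mul _
    · exact HasDerivAt.fun_sum fun i _ => ((hlin i x).cos).const_mul _
  refine (hd.const_add (a - G 0)).congr_deriv ?_
  rw [h, add_assoc, add_sub_cancel_left, add_comm]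
  congr 1 <;>
  · refine Finset.sum_congr rfl fun i hi => ?_
    have hi0 : (i : ℝ) ≠ 0 := by
      have := (Finset.mem_Icc.1 hi).1
      positivity
    field_simp

/-- A uniform trigonometric approximation of `f'` integrates to one of `f`. -/
theorem inG.exists_approx_primitive {f f' p : ℝ → ℝ} {N : ℕ} {δ : ℝ}
    (hf : ∀ x, HasDerivAt f (f' x) x) (hf01 : f 1 = f 0) (hp : inG N p)
    (hfp : ∀ x ∈ Set.Icc (0 : ℝ) 1, |f' x - p x| ≤ δ) :
    ∃ c F, inG N F ∧ (∀ x, HasDerivAt F (p x - c) x) ∧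
      ∀ x ∈ Set.Icc (0 : ℝ) 1, |f x - F x| ≤ 2 * δ ∧ |f' x - (p x - c)| ≤ 2 * δ := by
  obtain ⟨c, F, hF, hF0, hF1, hFd⟩ := hp.exists_primitive (f 0)
  have hmv : ∀ x ∈ Set.Icc (0 : ℝ) 1, |f x - F x - c * x| ≤ δ * x := by
    intro x hx
    have hd : ∀ y ∈ Set.Icc (0 : ℝ) 1,
        HasDerivWithinAt (fun y => f y - F y - c * y) (f' y - p y) (Set.Icc 0 1) y := by
      intro y _
      have := ((hf y).sub (hFd y)).sub ((hasDerivAt_id y).const_mul c)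
      exact (this.congr_deriv (by ring)).hasDerivWithinAt
    have := norm_image_sub_le_of_norm_deriv_le_segment' hd
      (fun y hy => hfp y ⟨hy.1, hy.2.le⟩) x hx
    simpa [hF0] using this
  have hc : |c| ≤ δ := by
    have := hmv 1 (by simp)
    simpa [hF1, hf01] using this
  refine ⟨c, F, hF, hFd, fun x hx => ⟨?_, ?_⟩⟩
  · have h1 := abs_le.1 (hmv x hx)
    have h2 := abs_le.1 hc
    have hx' := hx.1
    have hx'' := hx.2
    rw [abs_le]
    constructor <;> nlinarith
  · have h1 := abs_le.1 (hfp x hx)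
    have h2 := abs_le.1 hc
    rw [abs_le]
    constructor <;> linarith

theorem Function.Periodic.deriv_periodic {f : ℝ → ℝ} {T : ℝ} (hf : Function.Periodic f T) :
    Function.Periodic (deriv f) T := fun x => by
  rw [← deriv_comp_add_const, funext hf]

/-- Trigonometric polynomials approximate `C²` periodic functions in the `C²` norm. -/
theorem exists_inG_approx_deriv_deriv {f : ℝ → ℝ} (hf : ContDiff ℝ 2 f)
    (hfp : Function.Periodic f 1) {δ : ℝ} (hδ : 0 < δ) :
    ∃ N F, inG N F ∧ ContDiff ℝ 2 F ∧ ∀ x ∈ Set.Icc (0 : ℝ) 1,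
      |F x - f x| ≤ δ ∧ |deriv F x - deriv f x| ≤ δ ∧
        |deriv (deriv F) x - deriv (deriv f) x| ≤ δ := by
  have hf1 : ContDiff ℝ 1 (deriv f) := hf.deriv'
  obtain ⟨N, p, hp, hpf⟩ := exists_inG_approx (hf1.continuous_deriv le_rfl)
    hfp.deriv_periodic.deriv_periodic (show 0 < δ / 4 by positivity)
  obtain ⟨c, F₁, hF₁, hd₁, happ₁⟩ := hp.exists_approx_primitive
    (fun x => (hf1.differentiable one_ne_zero x).hasDerivAt)
    (by simpa using hfp.deriv_periodic 0) (fun x _ => hpf x)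
  obtain ⟨c', F, hF, hd, happ⟩ := hF₁.exists_approx_primitive
    (fun x => (hf.differentiable two_ne_zero x).hasDerivAt)
    (by simpa using hfp 0) (fun x hx => (happ₁ x hx).1)
  have hdF : deriv F = fun x => F₁ x - c' := funext fun x => (hd x).deriv
  have hddF : deriv (deriv F) = fun x => p x - c := by
    rw [hdF]
    funext x
    rw [deriv_sub_const, (hd₁ x).deriv]
  have hFc : ContDiff ℝ 2 F := by
    obtain ⟨a, α, β, hab⟩ := hF
    rw [funext hab]
    fun_prop
  refine ⟨N, F, hF, hFc, fun x hx => ?_⟩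
  rw [hddF, hdF, abs_sub_comm (F x), abs_sub_comm (F₁ x - c'), abs_sub_comm (p x - c)]
  have h1 := (happ₁ x hx).2
  have h2 := happ x hx
  exact ⟨by linarith [h2.1], by linarith [h2.2], by linarith⟩

theorem integral_sq_le_sq_of_abs_le {g : ℝ → ℝ} {ε : ℝ}
    (hg : ∀ x ∈ Set.Icc (0 : ℝ) 1, |g x| ≤ ε) : (∫ x in (0 : ℝ)..1, g x ^ 2) ≤ ε ^ 2 := by
  have h := intervalIntegral.norm_integral_le_of_norm_le_const (a := (0 : ℝ)) (b := 1)
    (f := fun x => g x ^ 2) (C := ε ^ 2) fun x hx => by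
      rw [Set.uIoc_of_le zero_le_one] at hx
      rw [norm_pow]
      exact pow_le_pow_left₀ (norm_nonneg _) (hg x ⟨hx.1.le, hx.2⟩) 2
  exact (le_abs_self _).trans (by simpa using h)

theorem abs_integral_sub_integral_le {f g : ℝ → ℝ} {ε : ℝ} (hf : Continuous f)
    (hg : Continuous g) (hfg : ∀ x ∈ Set.Icc (0 : ℝ) 1, |f x - g x| ≤ ε) :
    |(∫ x in (0 : ℝ)..1, f x) - ∫ x in (0 : ℝ)..1, g x| ≤ ε := by
  rw [← intervalIntegral.integral_sub (hf.intervalIntegrable _ _) (hg.intervalIntegrable _ _)]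
  have h := intervalIntegral.norm_integral_le_of_norm_le_const (a := (0 : ℝ)) (b := 1)
    (f := fun x => f x - g x) (C := ε) fun x hx => by
      rw [Set.uIoc_of_le zero_le_one] at hx
      exact hfg x ⟨hx.1.le, hx.2⟩
  simpa using h

theorem integral_sq_le_two_mul_integral_sq_add {f g : ℝ → ℝ} {ε : ℝ} (hf : Continuous f)
    (hg : Continuous g) (hfg : ∀ x ∈ Set.Icc (0 : ℝ) 1, |f x - g x| ≤ ε) :
    (∫ x in (0 : ℝ)..1, f x ^ 2) ≤ 2 * (∫ x in (0 : ℝ)..1, g x ^ 2) + 2 * ε ^ 2 := by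
  have h : (∫ x in (0 : ℝ)..1, f x ^ 2) ≤ ∫ x in (0 : ℝ)..1, (2 * g x ^ 2 + 2 * ε ^ 2) := by
    refine intervalIntegral.integral_mono_on zero_le_one
      (Continuous.intervalIntegrable (by fun_prop) _ _)
      (Continuous.intervalIntegrable (by fun_prop) _ _) fun x hx => ?_
    have h2 : (f x - g x) ^ 2 ≤ ε ^ 2 := sq_le_sq.2 ((hfg x hx).trans (le_abs_self ε))
    nlinarith [sq_nonneg (f x - 2 * g x)]
  rw [intervalIntegral.integral_add (Continuous.intervalIntegrable (by fun_prop) _ _)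
    (by simp), intervalIntegral.integral_const_mul] at h
  simpa using h

/-- A continuous function vanishing on `K × {t₀}`, `K` compact, is uniformly small on `K` for
parameters near `t₀`. -/
theorem IsCompact.exists_forall_dist_lt_abs_le {X P : Type*} [TopologicalSpace X]
    [PseudoMetricSpace P] {K : Set X} (hK : IsCompact K) {G : X × P → ℝ} (hG : Continuous G)
    {t₀ : P} (h0 : ∀ x ∈ K, G (x, t₀) = 0) {ε : ℝ} (hε : 0 < ε) :
    ∃ δ > 0, ∀ t, dist t t₀ < δ → ∀ x ∈ K, |G (x, t)| ≤ ε := by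
  have h : ∀ᶠ t in nhds t₀, ∀ x ∈ K, |G (x, t)| ≤ ε := by
    refine hK.eventually_forall_of_forall_eventually fun x hx => ?_
    have hlim : Filter.Tendsto (fun z : P × X => |G (z.2, z.1)|) (nhds (t₀, x)) (nhds 0) := by
      have hc : Continuous fun z : P × X => |G (z.2, z.1)| := by fun_prop
      simpa [h0 x hx] using hc.tendsto (t₀, x)
    exact hlim.eventually (eventually_le_nhds hε)
  obtain ⟨δ, hδ, h⟩ := Metric.eventually_nhds_iff.1 h
  exact ⟨δ, hδ, fun t ht => h ht⟩

/-- Theorem 2.4: upper bound on the minimum of `J_γ` via Fourier approximation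
of the exact smooth solution of the one-dimensional stationary MFG. -/
theorem stmt_6 (V b : ℝ → ℝ)
    (hV : ContDiff ℝ (⊤ : ℕ∞) V) (hVp : ∀ x, V (x + 1) = V x)
    (hb : ContDiff ℝ (⊤ : ℕ∞) b) (hbp : ∀ x, b (x + 1) = b x)
    (ustar mstar : ℝ → ℝ) (Hstar : ℝ)
    (hus : ContDiff ℝ (⊤ : ℕ∞) ustar) (husp : ∀ x, ustar (x + 1) = ustar x)
    (hms : ContDiff ℝ (⊤ : ℕ∞) mstar) (hmsp : ∀ x, mstar (x + 1) = mstar x)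
    (hmpos : ∀ x, 0 < mstar x)
    (hHJB : ∀ x, (deriv ustar x) ^ 2 / 2 + V x + b x * deriv ustar x
      = Real.log (mstar x) + Hstar)
    (hFP : ∀ x, deriv (fun y => mstar y * (deriv ustar y + b y)) x = 0)
    (hm1 : (∫ x in (0:ℝ)..1, mstar x) = 1)
    (hu0 : (∫ x in (0:ℝ)..1, ustar x) = 0) :
    ∃ C > 0, ∀ ε ∈ Set.Ioo (0:ℝ) 1, ∀ γ : ℝ, 0 < γ →
      ∃ (N : ℕ) (uN mN : ℝ → ℝ), inG N uN ∧ inG N mN ∧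
        Jfun V b γ uN mN Hstar ≤
          2 * (∫ x in (0:ℝ)..1, (ustar x) ^ 2) + 2 * (∫ x in (0:ℝ)..1, (mstar x) ^ 2)
            + Hstar ^ 2 + C * (1 + γ) * ε ^ 2 := by
  have hu2 : ContDiff ℝ 2 ustar := hus.of_le (by norm_cast)
  have hm2 : ContDiff ℝ 2 mstar := hms.of_le (by norm_cast)
  have hb1 : ContDiff ℝ 1 b := hb.of_le (by exact_mod_cast le_top)
  have hu1 : ContDiff ℝ 1 (deriv ustar) := hu2.deriv'
  have hVc : Continuous V := hV.continuous
  have hbc : Continuous b := hb.continuous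
  have hb'c : Continuous (deriv b) := hb1.continuous_deriv le_rfl
  have huc : Continuous ustar := hu2.continuous
  have hu'c : Continuous (deriv ustar) := hu1.continuous
  have hu''c : Continuous (deriv (deriv ustar)) := hu1.continuous_deriv le_rfl
  have hmc : Continuous mstar := hm2.continuous
  have hm'c : Continuous (deriv mstar) := hm2.continuous_deriv (by norm_num)
  -- the two residuals, with the errors in the derivatives of ustar and mstar as parameters
  let G₁ : ℝ × (ℝ × ℝ × ℝ × ℝ) → ℝ := fun z =>
    Real.exp (V z.1 + (deriv ustar z.1 + z.2.1) ^ 2 / 2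
      + b z.1 * (deriv ustar z.1 + z.2.1) - Hstar) - (mstar z.1 + z.2.2.2.1)
  let G₂ : ℝ × (ℝ × ℝ × ℝ × ℝ) → ℝ := fun z =>
    (mstar z.1 + z.2.2.2.1) * (deriv (deriv ustar) z.1 + z.2.2.1 + deriv b z.1)
      + (deriv mstar z.1 + z.2.2.2.2) * (deriv ustar z.1 + z.2.1 + b z.1)
  have hG₁ : Continuous G₁ := by fun_prop
  have hG₂ : Continuous G₂ := by fun_prop
  have hG₁0 : ∀ x ∈ Set.Icc (0 : ℝ) 1, G₁ (x, 0) = 0 := by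
    intro x _
    have : V x + deriv ustar x ^ 2 / 2 + b x * deriv ustar x - Hstar = Real.log (mstar x) := by
      linarith [hHJB x]
    simp [G₁, this, Real.exp_log (hmpos x)]
  have hG₂0 : ∀ x ∈ Set.Icc (0 : ℝ) 1, G₂ (x, 0) = 0 := by
    intro x _
    have hd := ((hm2.differentiable two_ne_zero x).hasDerivAt).mul
      (((hu1.differentiable one_ne_zero x).hasDerivAt).add
        ((hb1.differentiable one_ne_zero x).hasDerivAt))
    have h0 := hd.deriv.symm.trans (hFP x)
    simp only [G₂, Prod.fst_zero, Prod.snd_zero, add_zero]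
    simp only [Pi.add_apply] at h0
    linarith
  refine ⟨4, by norm_num, fun ε hε γ hγ => ?_⟩
  have hε0 : 0 < ε := hε.1
  obtain ⟨δ₁, hδ₁, h₁⟩ := isCompact_Icc.exists_forall_dist_lt_abs_le hG₁ hG₁0 hε0
  obtain ⟨δ₂, hδ₂, h₂⟩ := isCompact_Icc.exists_forall_dist_lt_abs_le hG₂ hG₂0 hε0
  obtain ⟨δ, hδ, hδ'⟩ := exists_between (lt_min hε0 (lt_min hδ₁ hδ₂))
  simp only [lt_min_iff] at hδ'
  obtain ⟨hδε, hδδ₁, hδδ₂⟩ := hδ'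
  obtain ⟨N, uN, huN, huNc, huN'⟩ := exists_inG_approx_deriv_deriv hu2 husp hδ
  obtain ⟨M, mN, hmN, hmNc, hmN'⟩ := exists_inG_approx_deriv_deriv hm2 hmsp hδ
  refine ⟨max N M, uN, mN, huN.mono (le_max_left _ _), hmN.mono (le_max_right _ _), ?_⟩
  have huε : ∀ x ∈ Set.Icc (0 : ℝ) 1, |uN x - ustar x| ≤ ε :=
    fun x hx => (huN' x hx).1.trans hδε.le
  have hmε : ∀ x ∈ Set.Icc (0 : ℝ) 1, |mN x - mstar x| ≤ ε :=
    fun x hx => (hmN' x hx).1.trans hδε.le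
  have hdist : ∀ x ∈ Set.Icc (0 : ℝ) 1,
      dist (deriv uN x - deriv ustar x, deriv (deriv uN) x - deriv (deriv ustar) x,
        mN x - mstar x, deriv mN x - deriv mstar x) 0 ≤ δ := by
    intro x hx
    obtain ⟨-, hu1, hu2⟩ := huN' x hx
    obtain ⟨hm0, hm1, -⟩ := hmN' x hx
    simpa [Prod.norm_def] using ⟨hu1, hu2, hm0, hm1⟩
  have hI₁ : (∫ x in (0:ℝ)..1, (Real.exp (V x + (deriv uN x) ^ 2 / 2
      + b x * deriv uN x - Hstar) - mN x) ^ 2) ≤ ε ^ 2 := by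
    refine integral_sq_le_sq_of_abs_le fun x hx => ?_
    simpa [G₁] using h₁ _ ((hdist x hx).trans_lt hδδ₁) x hx
  have hI₂ : (∫ x in (0:ℝ)..1, (mN x * (deriv (deriv uN) x + deriv b x)
      + deriv mN x * (deriv uN x + b x)) ^ 2) ≤ ε ^ 2 := by
    refine integral_sq_le_sq_of_abs_le fun x hx => ?_
    simpa [G₂] using h₂ _ ((hdist x hx).trans_lt hδδ₂) x hx
  have hu_int := abs_integral_sub_integral_le huNc.continuous huc huε
  have hm_int := abs_integral_sub_integral_le hmNc.continuous hmc hmε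
  rw [hu0, sub_zero] at hu_int
  rw [hm1] at hm_int
  have hu_int_sq := sq_le_sq.2 (hu_int.trans (le_abs_self ε))
  have hm_int_sq := sq_le_sq.2 (hm_int.trans (le_abs_self ε))
  have hQ : Qfun V b uN mN Hstar ≤ 4 * ε ^ 2 := by
    unfold Qfun
    linarith
  have hu_sq := integral_sq_le_two_mul_integral_sq_add huNc.continuous huc huε
  have hm_sq := integral_sq_le_two_mul_integral_sq_add hmNc.continuous hmc hmε
  unfold Jfun
  linarith [mul_le_mul_of_nonneg_left hQ hγ.le]
end

section
/- Let V, h, g : ℝ → ℝ be continuous 1-periodic functions, b : ℝ → ℝ continuously differentiable and 1-periodic, u¹, u² : ℝ → ℝ twice continuously differentiable and 1-periodic, m¹, m² : ℝ → ℝ continuously differentiable and 1-periodic with m¹(x) + h(x) > 0 and m²(x) > 0 for all x, and H̄¹, H̄² ∈ ℝ. Suppose that for all x ∈ ℝ: (u¹)'(x)²/2 + V(x) + b(x)(u¹)'(x) = ln(m¹(x) + h(x)) + H̄¹, −(m¹·((u¹)' + b))'(x) = g(x), (u²)'(x)²/2 + V(x) + b(x)(u²)'(x) = ln m²(x) + H̄²,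 and (m²·((u²)' + b))'(x) = 0. Then (1/2)∫₀¹ (m¹ + h)|(u²)' − (u¹)'|² dx + (1/2)∫₀¹ m²|(u²)' − (u¹)'|² dx + ∫₀¹ (ln(m¹ + h) − ln m²)(m¹ + h − m²) dx = (H̄² − H̄¹)∫₀¹ (m¹ + h − m²) dx + ∫₀¹ g·(u¹ − u²) dx + ∫₀¹ h·((u¹)' + b)·((u¹)' − (u²)') dx. -/
theorem deriv_add_one_of_periodic {u : ℝ → ℝ} (hu : ∀ x, u (x + 1) = u x) (x : ℝ) :
    deriv u (x + 1) = deriv u x := by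
  rw [← deriv_comp_add_const u 1 x]
  simp only [hu]

/-- The derivative of a product of 1-periodic functions has zero mean. -/
theorem integral_deriv_mul_eq_zero_of_periodic {f w f' w' : ℝ → ℝ}
    (hf : ∀ x, HasDerivAt f (f' x) x) (hw : ∀ x, HasDerivAt w (w' x) x)
    (hf' : Continuous f') (hw' : Continuous w')
    (hfp : ∀ x, f (x + 1) = f x) (hwp : ∀ x, w (x + 1) = w x) :
    ∫ x in (0:ℝ)..1, (f' x * w x + f x * w' x) = 0 := by
  rw [intervalIntegral.integral_deriv_mul_eq_sub (fun x _ => hf x) (fun x _ => hw x)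
    (hf'.intervalIntegrable _ _) (hw'.intervalIntegrable _ _)]
  have h1 := hfp 0
  have h2 := hwp 0
  rw [zero_add] at h1 h2
  rw [h1, h2, sub_self]

/-- The one-dimensional Lasry–Lions monotonicity identity (2.44), obtained by
cross-multiplying the perturbed and exact MFG systems and integrating by parts
over the torus. -/
theorem stmt_9 (V h g b : ℝ → ℝ) (u1 u2 m1 m2 : ℝ → ℝ) (H1 H2 : ℝ)
    (hV : Continuous V) (hVp : ∀ x, V (x + 1) = V x)
    (hh : Continuous h) (hhp : ∀ x, h (x + 1) = h x)
    (hg : Continuous g) (hgp : ∀ x, g (x + 1) = g x)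
    (hb : ContDiff ℝ 1 b) (hbp : ∀ x, b (x + 1) = b x)
    (hu1 : ContDiff ℝ 2 u1) (hu1p : ∀ x, u1 (x + 1) = u1 x)
    (hu2 : ContDiff ℝ 2 u2) (hu2p : ∀ x, u2 (x + 1) = u2 x)
    (hm1 : ContDiff ℝ 1 m1) (hm1p : ∀ x, m1 (x + 1) = m1 x)
    (hm2 : ContDiff ℝ 1 m2) (hm2p : ∀ x, m2 (x + 1) = m2 x)
    (hpos1 : ∀ x, 0 < m1 x + h x) (hpos2 : ∀ x, 0 < m2 x)
    (heq1 : ∀ x, (deriv u1 x) ^ 2 / 2 + V x + b x * deriv u1 x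
      = Real.log (m1 x + h x) + H1)
    (heq2 : ∀ x, -(deriv (fun y => m1 y * (deriv u1 y + b y)) x) = g x)
    (heq3 : ∀ x, (deriv u2 x) ^ 2 / 2 + V x + b x * deriv u2 x
      = Real.log (m2 x) + H2)
    (heq4 : ∀ x, deriv (fun y => m2 y * (deriv u2 y + b y)) x = 0) :
    (1/2) * (∫ x in (0:ℝ)..1, (m1 x + h x) * (deriv u2 x - deriv u1 x) ^ 2)
    + (1/2) * (∫ x in (0:ℝ)..1, m2 x * (deriv u2 x - deriv u1 x) ^ 2)
    + (∫ x in (0:ℝ)..1,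
        (Real.log (m1 x + h x) - Real.log (m2 x)) * (m1 x + h x - m2 x))
    = (H2 - H1) * (∫ x in (0:ℝ)..1, (m1 x + h x - m2 x))
      + (∫ x in (0:ℝ)..1, g x * (u1 x - u2 x))
      + ∫ x in (0:ℝ)..1, h x * (deriv u1 x + b x) * (deriv u1 x - deriv u2 x) := by
  have cb := hb.continuous
  have cm1 := hm1.continuous
  have cm2 := hm2.continuous
  have cu1 := hu1.continuous
  have cu2 := hu2.continuous
  have dp1 : ContDiff ℝ 1 (deriv u1) := hu1.deriv'
  have dp2 : ContDiff ℝ 1 (deriv u2) := hu2.deriv'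
  have cp1 := dp1.continuous
  have cp2 := dp2.continuous
  have clog1 : Continuous fun x => Real.log (m1 x + h x) :=
    (cm1.add hh).log fun x => (hpos1 x).ne'
  have clog2 : Continuous fun x => Real.log (m2 x) := cm2.log fun x => (hpos2 x).ne'
  have hflux1 (x : ℝ) : HasDerivAt (fun y => m1 y * (deriv u1 y + b y)) (-g x) x := by
    have hd := ((hm1.mul (dp1.add hb)).differentiable one_ne_zero x).hasDerivAt
    rw [← heq2 x, neg_neg]
    exact hd
  have hflux2 (x : ℝ) : HasDerivAt (fun y => m2 y * (deriv u2 y + b y)) 0 x := by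
    have hd := ((hm2.mul (dp2.add hb)).differentiable one_ne_zero x).hasDerivAt
    rw [← heq4 x]
    exact hd
  have hw (x : ℝ) : HasDerivAt (fun y => u1 y - u2 y) (deriv u1 x - deriv u2 x) x :=
    (hu1.differentiable two_ne_zero x).hasDerivAt.sub
      (hu2.differentiable two_ne_zero x).hasDerivAt
  have hparts := integral_deriv_mul_eq_zero_of_periodic
    (fun x => (hflux1 x).sub (hflux2 x)) hw (by fun_prop) (by fun_prop)
    (fun x => by simp [deriv_add_one_of_periodic hu1p, deriv_add_one_of_periodic hu2p,
      hm1p, hm2p, hbp])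
    (fun x => by simp only [hu1p, hu2p])
  have hadd {f k : ℝ → ℝ} (hf : Continuous f) (hk : Continuous k) :
      (∫ x in (0:ℝ)..1, f x) + ∫ x in (0:ℝ)..1, k x = ∫ x in (0:ℝ)..1, (f x + k x) :=
    (intervalIntegral.integral_add (hf.intervalIntegrable 0 1) (hk.intervalIntegrable 0 1)).symm
  refine Eq.trans ?_ ((congrArg (_ + ·) hparts).trans (add_zero _))
  simp only [← intervalIntegral.integral_const_mul]
  simp only [Pi.sub_apply]
  rw [hadd, hadd, hadd, hadd, hadd]
  any_goals fun_prop
  refine intervalIntegral.integral_congr fun x _ => ?_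
  have e1 : Real.log (m1 x + h x) = _ := eq_sub_of_add_eq (heq1 x).symm
  have e2 : Real.log (m2 x) = _ := eq_sub_of_add_eq (heq3 x).symm
  simp only [e1, e2]
  ring
end

section
/- Fix an integer d ≥ 1. Let u¹, u², m¹, m² : ℝ^d → ℝ be twice continuously differentiable and ℤ^d-periodic, let V, f¹, f², h, g : ℝ^d → ℝ be continuous and ℤ^d-periodic, and let H̄¹, H̄² ∈ ℝ. Suppose that for all x ∈ ℝ^d: −Δu¹ + |∇u¹|²/2 + V = f¹ + H̄¹ + h, −Δm¹ − ⟨∇m¹, ∇u¹⟩ − m¹Δu¹ = g, −Δu² + |∇u²|²/2 + V = f² + H̄², and −Δm² − ⟨∇m², ∇u²⟩ − m²Δu² = 0. Set w = u¹ − u², ρ = m¹ − m², τ = H̄¹ − H̄². Then (1/2)∫_{[0,1]^d} |∇w|² (m¹ + m²) dx + ∫_{[0,1]^d} (f¹ − f²)(m¹ − m²) dx = −τ ∫_{[0,1]^d} ρ dx − ∫_{[0,1]^d} h ρ dx + ∫_{[0,1]^d} g w dx. -/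
open MeasureTheory

/-- The partial derivative `∂f/∂xᵢ` of `f : ℝ^d → ℝ`. -/
noncomputable def pd (d : ℕ) (f : (Fin d → ℝ) → ℝ) (i : Fin d) (x : Fin d → ℝ) : ℝ :=
  fderiv ℝ f x (Pi.single i 1)

/-- The Laplacian `Δf = Σᵢ ∂²f/∂xᵢ²`. -/
noncomputable def lapl (d : ℕ) (f : (Fin d → ℝ) → ℝ) (x : Fin d → ℝ) : ℝ :=
  ∑ i, pd d (pd d f i) i x

/-- The squared gradient norm `|∇f|² = Σᵢ (∂f/∂xᵢ)²`. -/
noncomputable def gradSq (d : ℕ) (f : (Fin d → ℝ) → ℝ) (x : Fin d → ℝ) : ℝ :=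
  ∑ i, (pd d f i x) ^ 2

/-- The inner product of gradients `⟨∇f, ∇g⟩ = Σᵢ (∂f/∂xᵢ)(∂g/∂xᵢ)`. -/
noncomputable def gradDot (d : ℕ) (f g : (Fin d → ℝ) → ℝ) (x : Fin d → ℝ) : ℝ :=
  ∑ i, pd d f i x * pd d g i x

/-- `ℤ^d`-periodicity of `f : ℝ^d → ℝ`. -/
def ZPeriodic (d : ℕ) (f : (Fin d → ℝ) → ℝ) : Prop :=
  ∀ (x : Fin d → ℝ) (k : Fin d → ℤ), f (x + fun i => (k i : ℝ)) = f x

section Helpers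

variable {d : ℕ} {f g : (Fin d → ℝ) → ℝ} {i : Fin d}

lemma pd_add (hf : Differentiable ℝ f) (hg : Differentiable ℝ g) (x : Fin d → ℝ) :
    pd d (fun y => f y + g y) i x = pd d f i x + pd d g i x := by
  simp [pd, fderiv_fun_add (hf x) (hg x)]

lemma pd_sub (hf : Differentiable ℝ f) (hg : Differentiable ℝ g) (x : Fin d → ℝ) :
    pd d (fun y => f y - g y) i x = pd d f i x - pd d g i x := by
  simp [pd, fderiv_fun_sub (hf x) (hg x)]

lemma pd_mul (hf : Differentiable ℝ f) (hg : Differentiable ℝ g) (x : Fin d → ℝ) :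
    pd d (fun y => f y * g y) i x = f x * pd d g i x + g x * pd d f i x := by
  simp [pd, fderiv_fun_mul (hf x) (hg x)]

lemma contDiff_pd {n : WithTop ℕ∞} (hf : ContDiff ℝ (n + 1) f) : ContDiff ℝ n (pd d f i) :=
  (hf.fderiv_right le_rfl).clm_apply contDiff_const

lemma ZPeriodic.pd (hf : ZPeriodic d f) : ZPeriodic d (pd d f i) := by
  intro x k
  unfold _root_.pd
  rw [← fderiv_comp_add_right]
  simp_rw [hf _ k]

/-- The integral over the unit cube of a partial derivative of a periodic `C¹` function is zero. -/
lemma integral_pd_eq_zero (hf : ContDiff ℝ 1 f) (hp : ZPeriodic d f) :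
    ∫ x in Set.Icc (0 : Fin d → ℝ) 1, pd d f i x = 0 := by
  obtain _ | n := d
  · exact i.elim0
  have hcont : Continuous (pd (n + 1) f i) := (contDiff_pd (n := 0) hf).continuous
  let F : Fin (n + 1) → (Fin (n + 1) → ℝ) → ℝ := fun j => if j = i then f else fun _ => 0
  let F' : Fin (n + 1) → (Fin (n + 1) → ℝ) → (Fin (n + 1) → ℝ) →L[ℝ] ℝ :=
    fun j => if j = i then fderiv ℝ f else fun _ => 0
  have hsum : ∀ x, ∑ j, F' j x (Pi.single j 1) = pd (n + 1) f i x := by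
    intro x
    rw [Finset.sum_eq_single i (fun j _ hj => by simp [F', hj]) (by simp)]
    simp [F', pd]
  have key := integral_divergence_of_hasFDerivAt_off_countable' (0 : Fin (n + 1) → ℝ) 1
    zero_le_one F F' ∅ Set.countable_empty
    (fun j => by
      by_cases hj : j = i
      · simpa [F, hj] using hf.continuous.continuousOn
      · simpa only [F, hj, if_false] using continuousOn_const)
    (fun x _ j => by
      by_cases hj : j = i
      · simpa [F, F', hj] using (hf.differentiable one_ne_zero x).hasFDerivAt
      · simpa only [F, F', hj, if_false] using hasFDerivAt_const (0 : ℝ) x)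
    (by
      simp_rw [hsum]
      exact hcont.continuousOn.integrableOn_compact isCompact_Icc)
  simp_rw [hsum] at key
  rw [key]
  refine Finset.sum_eq_zero fun j _ => sub_eq_zero.2 (integral_congr_ae (ae_of_all _ fun x => ?_))
  by_cases hj : j = i
  · subst hj
    have hx := hp (j.insertNth 0 x) (Pi.single j 1)
    have hshift : (j.insertNth 0 x + fun l => (((Pi.single j 1 : Fin (n + 1) → ℤ) l : ℤ) : ℝ))
        = j.insertNth (1 : ℝ) x := by
      ext l
      refine Fin.succAboveCases j ?_ (fun l => ?_) l <;> simp
    rw [hshift] at hx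
    simpa [F] using hx
  · simp [F, hj]

end Helpers

/-- The `d`-dimensional Lasry–Lions monotonicity identity from the proof of
Theorem 3.6, obtained by cross-multiplying the perturbed and exact second-order
MFG systems and integrating by parts over the torus. -/
theorem stmt_13 (d : ℕ) (hd : 1 ≤ d)
    (u1 u2 m1 m2 : (Fin d → ℝ) → ℝ)
    (hu1 : ContDiff ℝ 2 u1) (hu1p : ZPeriodic d u1)
    (hu2 : ContDiff ℝ 2 u2) (hu2p : ZPeriodic d u2)
    (hm1 : ContDiff ℝ 2 m1) (hm1p : ZPeriodic d m1)
    (hm2 : ContDiff ℝ 2 m2) (hm2p : ZPeriodic d m2)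
    (V f1 f2 h g : (Fin d → ℝ) → ℝ)
    (hV : Continuous V) (hVp : ZPeriodic d V)
    (hf1 : Continuous f1) (hf1p : ZPeriodic d f1)
    (hf2 : Continuous f2) (hf2p : ZPeriodic d f2)
    (hh : Continuous h) (hhp : ZPeriodic d h)
    (hg : Continuous g) (hgp : ZPeriodic d g)
    (H1 H2 : ℝ)
    (heq1 : ∀ x, -lapl d u1 x + gradSq d u1 x / 2 + V x = f1 x + H1 + h x)
    (heq2 : ∀ x, -lapl d m1 x - gradDot d m1 u1 x - m1 x * lapl d u1 x = g x)
    (heq3 : ∀ x, -lapl d u2 x + gradSq d u2 x / 2 + V x = f2 x + H2)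
    (heq4 : ∀ x, -lapl d m2 x - gradDot d m2 u2 x - m2 x * lapl d u2 x = 0) :
    (1/2) * (∫ x in Set.Icc (0 : Fin d → ℝ) 1,
        gradSq d (fun y => u1 y - u2 y) x * (m1 x + m2 x))
      + (∫ x in Set.Icc (0 : Fin d → ℝ) 1, (f1 x - f2 x) * (m1 x - m2 x))
    = -(H1 - H2) * (∫ x in Set.Icc (0 : Fin d → ℝ) 1, (m1 x - m2 x))
      - (∫ x in Set.Icc (0 : Fin d → ℝ) 1, h x * (m1 x - m2 x))
      + ∫ x in Set.Icc (0 : Fin d → ℝ) 1, g x * (u1 x - u2 x) := by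
  have hdiff {f : (Fin d → ℝ) → ℝ} (hf : ContDiff ℝ 2 f) : Differentiable ℝ f :=
    hf.differentiable two_ne_zero
  have hC1 {f : (Fin d → ℝ) → ℝ} (hf : ContDiff ℝ 2 f) : ContDiff ℝ 1 f :=
    hf.of_le one_le_two
  have hpd {f : (Fin d → ℝ) → ℝ} (hf : ContDiff ℝ 2 f) (i : Fin d) : ContDiff ℝ 1 (pd d f i) :=
    contDiff_pd (by simpa [one_add_one_eq_two] using hf)
  have hpdd {f : (Fin d → ℝ) → ℝ} (hf : ContDiff ℝ 2 f) (i : Fin d) :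
      Differentiable ℝ (pd d f i) := (hpd hf i).differentiable one_ne_zero
  have hu1d := hdiff hu1
  have hu2d := hdiff hu2
  have hm1d := hdiff hm1
  have hm2d := hdiff hm2
  let G : Fin d → (Fin d → ℝ) → ℝ := fun i x =>
    (u1 x - u2 x) * (pd d m1 i x - pd d m2 i x + (m1 x * pd d u1 i x - m2 x * pd d u2 i x))
      - (m1 x - m2 x) * (pd d u1 i x - pd d u2 i x)
  have hG : ∀ i, ContDiff ℝ 1 (G i) := fun i =>
    (((hC1 hu1).sub (hC1 hu2)).mul (((hpd hm1 i).sub (hpd hm2 i)).add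
      (((hC1 hm1).mul (hpd hu1 i)).sub ((hC1 hm2).mul (hpd hu2 i))))).sub
      (((hC1 hm1).sub (hC1 hm2)).mul ((hpd hu1 i).sub (hpd hu2 i)))
  have hGp : ∀ i, ZPeriodic d (G i) := fun i x k => by
    simp only [G, hu1p x k, hu2p x k, hm1p x k, hm2p x k, hu1p.pd x k, hu2p.pd x k,
      hm1p.pd x k, hm2p.pd x k]
  have hpdG : ∀ i x, pd d (G i) i x =
      (pd d u1 i x - pd d u2 i x) *
          (pd d m1 i x - pd d m2 i x + (m1 x * pd d u1 i x - m2 x * pd d u2 i x))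
        + (u1 x - u2 x) * (pd d (pd d m1 i) i x - pd d (pd d m2 i) i x
          + (m1 x * pd d (pd d u1 i) i x + pd d u1 i x * pd d m1 i x
            - (m2 x * pd d (pd d u2 i) i x + pd d u2 i x * pd d m2 i x)))
        - (pd d m1 i x - pd d m2 i x) * (pd d u1 i x - pd d u2 i x)
        - (m1 x - m2 x) * (pd d (pd d u1 i) i x - pd d (pd d u2 i) i x) := fun i x => by
    have h1 := hpdd hu1 i
    have h2 := hpdd hu2 i
    have h3 := hpdd hm1 i
    have h4 := hpdd hm2 i
    simp only [G]
    rw [pd_sub (by fun_prop) (by fun_prop), pd_mul (by fun_prop) (by fun_prop),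
      pd_mul (by fun_prop) (by fun_prop), pd_sub hu1d hu2d, pd_sub hm1d hm2d, pd_sub h1 h2,
      pd_add (by fun_prop) (by fun_prop), pd_sub h3 h4, pd_sub (by fun_prop) (by fun_prop),
      pd_mul hm1d h1, pd_mul hm2d h2]
    ring
  have hdiv : ∀ x, ∑ i, pd d (G i) i x =
      (u1 x - u2 x) * (lapl d m1 x - lapl d m2 x
          + (m1 x * lapl d u1 x + gradDot d m1 u1 x - (m2 x * lapl d u2 x + gradDot d m2 u2 x)))
        - (m1 x - m2 x) * (lapl d u1 x - lapl d u2 x)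
        + (1 / 2) * (m1 x - m2 x) * (gradSq d u1 x - gradSq d u2 x)
        + (1 / 2) * (gradSq d (fun y => u1 y - u2 y) x * (m1 x + m2 x)) := fun x => by
    simp only [lapl, gradDot, gradSq, Finset.mul_sum, Finset.sum_mul, ← Finset.sum_add_distrib,
      ← Finset.sum_sub_distrib]
    refine Finset.sum_congr rfl fun i _ => ?_
    rw [hpdG, pd_sub hu1d hu2d]
    ring
  have hpoint : ∀ x, ∑ i, pd d (G i) i x =
      (1 / 2) * (gradSq d (fun y => u1 y - u2 y) x * (m1 x + m2 x))
        + (f1 x - f2 x) * (m1 x - m2 x) + (H1 - H2) * (m1 x - m2 x) + h x * (m1 x - m2 x)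
        - g x * (u1 x - u2 x) := fun x => by
    rw [hdiv]
    linear_combination (m1 x - m2 x) * (heq1 x - heq3 x) - (u1 x - u2 x) * (heq2 x - heq4 x)
  have hzero : ∫ x in Set.Icc (0 : Fin d → ℝ) 1, ∑ i, pd d (G i) i x = 0 := by
    rw [integral_finsetSum _ fun i _ => (contDiff_pd (n := 0) (hG i)).continuous.continuousOn
      |>.integrableOn_compact isCompact_Icc]
    exact Finset.sum_eq_zero fun i _ => integral_pd_eq_zero (hG i) (hGp i)
  have hint {f : (Fin d → ℝ) → ℝ} (hf : Continuous f) :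
      Integrable f (volume.restrict (Set.Icc (0 : Fin d → ℝ) 1)) :=
    hf.continuousOn.integrableOn_compact isCompact_Icc
  have hu1c := hu1.continuous
  have hu2c := hu2.continuous
  have hm1c := hm1.continuous
  have hm2c := hm2.continuous
  have hgrad : Continuous (gradSq d (fun y => u1 y - u2 y)) :=
    continuous_finsetSum _ fun i _ => (hpd (hu1.sub hu2) i).continuous.pow 2
  simp_rw [hpoint] at hzero
  rw [integral_sub (hint (by fun_prop)) (hint (by fun_prop)),
    integral_add (hint (by fun_prop)) (hint (by fun_prop)),
    integral_add (hint (by fun_prop)) (hint (by fun_prop)),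
    integral_add (hint (by fun_prop)) (hint (by fun_prop)),
    integral_const_mul, integral_const_mul] at hzero
  linarith
end
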